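/- arXiv:2106.14255 — 3 statements merged into one kernel-verified Lean document; each statement's English description precedes it below -/
import Mathlib

section
/- For any integer n ≥ 2 and any α ∈ (0, π/2), there exists a finite set A of unit vectors in ℝⁿ such that for all distinct x, y ∈ A one has |⟨x, y⟩| < cos α (i.e., the angle between the lines through the origin spanned by x and y is greater than α), and the cardinality of A satisfies |A| > m_α(n), where m_α(n) := (π(n−1)/2)^{1/2} · cos α · (sin α)^{−(n−1)}. -/
open MeasureTheory Real Filter
open scoped InnerProductSpace

/-- A one-sided half of the tail integral of `|t| exp (-t²)`. -/
lemma lintegral_Ioi_abs_mul_exp_neg_sq {a : ℝ} (ha : 0 ≤ a) :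
    ∫⁻ t in Set.Ioi a, ENNReal.ofReal (|t| * rexp (-t ^ 2)) =
      ENNReal.ofReal (rexp (-a ^ 2) / 2) := by
  have hderiv : ∀ x ∈ Set.Ici a,
      HasDerivAt (fun t : ℝ => -(rexp (-t ^ 2) / 2)) (x * rexp (-x ^ 2)) x := by
    intro x _
    have h : HasDerivAt (fun t : ℝ => -(rexp (-t ^ 2) / 2)) _ x :=
      (((hasDerivAt_pow 2 x).fun_neg.exp).div_const 2).fun_neg
    refine h.congr_deriv ?_
    push_cast
    ring
  have hnonneg : ∀ x ∈ Set.Ioi a, 0 ≤ x * rexp (-x ^ 2) := fun x hx =>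
    mul_nonneg (ha.trans (le_of_lt hx)) (Real.exp_nonneg _)
  have hlim : Tendsto (fun t : ℝ => -(rexp (-t ^ 2) / 2)) atTop (nhds 0) := by
    have h : Tendsto (fun t : ℝ => rexp (-t ^ 2)) atTop (nhds 0) :=
      Real.tendsto_exp_neg_atTop_nhds_zero.comp (tendsto_pow_atTop two_ne_zero)
    simpa using (h.div_const 2).neg
  have hint := integrableOn_Ioi_deriv_of_nonneg' hderiv hnonneg hlim
  have hval := integral_Ioi_of_hasDerivAt_of_nonneg' hderiv hnonneg hlim
  have hcongr : ∫⁻ t in Set.Ioi a, ENNReal.ofReal (|t| * rexp (-t ^ 2)) =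
      ∫⁻ t in Set.Ioi a, ENNReal.ofReal (t * rexp (-t ^ 2)) :=
    setLIntegral_congr_fun measurableSet_Ioi fun t ht => by
      simp only [abs_of_nonneg (ha.trans (le_of_lt ht))]
  rw [hcongr, ← ofReal_integral_eq_lintegral_ofReal hint
    ((ae_restrict_iff' measurableSet_Ioi).2 (Eventually.of_forall hnonneg)), hval]
  simp

lemma lintegral_abs_mul_exp_neg_sq_tail_le {a : ℝ} (ha : 0 ≤ a) :
    ∫⁻ t in {t : ℝ | a ≤ |t|}, ENNReal.ofReal (|t| * rexp (-t ^ 2)) ≤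
      ENNReal.ofReal (rexp (-a ^ 2)) := by
  have hset : {t : ℝ | a ≤ |t|} = Set.Ici a ∪ Set.Iic (-a) := by
    ext t
    simp only [Set.mem_ofPred_eq, Set.mem_union, Set.mem_Ici, Set.mem_Iic, le_abs]
    exact or_congr Iff.rfl le_neg
  have hneg : ∫⁻ t in Set.Iic (-a), ENNReal.ofReal (|t| * rexp (-t ^ 2)) =
      ∫⁻ t in Set.Ici a, ENNReal.ofReal (|t| * rexp (-t ^ 2)) := by
    have h := (Measure.measurePreserving_neg (volume : Measure ℝ)).setLIntegral_comp_preimage_emb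
      (MeasurableEquiv.neg ℝ).measurableEmbedding
      (fun t => ENNReal.ofReal (|t| * rexp (-t ^ 2))) (Set.Iic (-a))
    rw [← h]
    simp
  rw [hset]
  refine (lintegral_union_le _ _ _).trans ?_
  rw [hneg, setLIntegral_congr Ioi_ae_eq_Ici.symm, lintegral_Ioi_abs_mul_exp_neg_sq ha,
    ← ENNReal.ofReal_add (by positivity) (by positivity), add_halves]

lemma lintegral_exp_neg_mul_sum_sq {ι : Type*} [Fintype ι] {b : ℝ} (hb : 0 < b) :
    ∫⁻ z : ι → ℝ, ENNReal.ofReal (rexp (-b * ∑ i, z i ^ 2)) =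
      ENNReal.ofReal (√(π / b) ^ Fintype.card ι) := by
  have hprod : ∀ z : ι → ℝ, rexp (-b * ∑ i, z i ^ 2) = ∏ i, rexp (-b * z i ^ 2) := fun z => by
    rw [Finset.mul_sum, Real.exp_sum]
  simp_rw [hprod]
  rw [volume_pi]
  rw [← ofReal_integral_eq_lintegral_ofReal
    (Integrable.fintype_prod (f := fun (_ : ι) (t : ℝ) => rexp (-b * t ^ 2))
      fun _ => integrable_exp_neg_mul_sq hb)
    (Eventually.of_forall fun z => Finset.prod_nonneg fun _ _ => Real.exp_nonneg _)]
  have h := integral_fintype_prod_volume_eq_pow (ι := ι) (fun t : ℝ => rexp (-b * t ^ 2))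
  rw [integral_gaussian] at h
  exact congrArg _ h

lemma lintegral_prod_tail_le {d : ℕ} {c s : ℝ} (hc : 0 < c) (hs : 0 < s)
    (hcs : s ^ 2 + c ^ 2 = 1) :
    ∫⁻ p : ℝ × (Fin d → ℝ), {p : ℝ × (Fin d → ℝ) | c / s * √(∑ i, p.2 i ^ 2) ≤ |p.1|}.indicator
      (fun p => ENNReal.ofReal (|p.1| * rexp (-p.1 ^ 2)) *
        ENNReal.ofReal (rexp (-∑ i, p.2 i ^ 2) / c)) p ≤
      ENNReal.ofReal (√π ^ d * s ^ d / c) := by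
  have hS : MeasurableSet {p : ℝ × (Fin d → ℝ) | c / s * √(∑ i, p.2 i ^ 2) ≤ |p.1|} :=
    measurableSet_le (by fun_prop) (by fun_prop)
  rw [Measure.volume_eq_prod, lintegral_prod_symm' _ (Measurable.indicator (by fun_prop) hS)]
  have hinner : ∀ z : Fin d → ℝ,
      ∫⁻ t : ℝ, {p : ℝ × (Fin d → ℝ) | c / s * √(∑ i, p.2 i ^ 2) ≤ |p.1|}.indicator
        (fun p => ENNReal.ofReal (|p.1| * rexp (-p.1 ^ 2)) *
          ENNReal.ofReal (rexp (-∑ i, p.2 i ^ 2) / c)) (t, z) ≤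
      ENNReal.ofReal (rexp (-(1 / s ^ 2) * ∑ i, z i ^ 2)) * ENNReal.ofReal (1 / c) := by
    intro z
    have hq : 0 ≤ ∑ i, z i ^ 2 := Finset.sum_nonneg fun i _ => sq_nonneg _
    set q := ∑ i, z i ^ 2 with hqdef
    have hset : MeasurableSet {t : ℝ | c / s * √q ≤ |t|} :=
      measurableSet_le (by fun_prop) (by fun_prop)
    calc _ = ∫⁻ t in {t : ℝ | c / s * √q ≤ |t|}, ENNReal.ofReal (|t| * rexp (-t ^ 2)) *
          ENNReal.ofReal (rexp (-q) / c) := by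
          rw [← lintegral_indicator hset]
          rfl
      _ = (∫⁻ t in {t : ℝ | c / s * √q ≤ |t|}, ENNReal.ofReal (|t| * rexp (-t ^ 2))) *
          ENNReal.ofReal (rexp (-q) / c) := lintegral_mul_const' _ _ ENNReal.ofReal_ne_top
      _ ≤ ENNReal.ofReal (rexp (-(c / s * √q) ^ 2)) * ENNReal.ofReal (rexp (-q) / c) := by
          gcongr
          exact lintegral_abs_mul_exp_neg_sq_tail_le (by positivity)
      _ = _ := by
          rw [← ENNReal.ofReal_mul (by positivity), ← ENNReal.ofReal_mul (by positivity),
            ← mul_div_assoc, ← Real.exp_add, mul_one_div]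
          congr 4
          rw [mul_pow, Real.sq_sqrt hq, div_pow]
          field_simp
          linear_combination (-q) * hcs
  refine (lintegral_mono hinner).trans ?_
  rw [lintegral_mul_const' _ _ ENNReal.ofReal_ne_top,
    lintegral_exp_neg_mul_sum_sq (by positivity), ← ENNReal.ofReal_mul (by positivity)]
  apply le_of_eq
  congr 1
  rw [div_div_eq_mul_div, div_one, Real.sqrt_mul Real.pi_pos.le, Real.sqrt_sq hs.le,
    Fintype.card_fin]
  ring

/-- The mass of a closed double cone with respect to the weight `‖x‖ exp (-‖x‖²)`. -/
lemma lintegral_cone_le {d : ℕ} {c s : ℝ} (hc : 0 < c) (hs : 0 < s) (hcs : s ^ 2 + c ^ 2 = 1)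
    {y : EuclideanSpace ℝ (Fin (d + 1))} (hy : ‖y‖ = 1) :
    ∫⁻ x in {x | c * ‖x‖ ≤ |⟪y, x⟫_ℝ|}, ENNReal.ofReal (‖x‖ * rexp (-‖x‖ ^ 2)) ≤
      ENNReal.ofReal (√π ^ d * s ^ d / c) := by
  obtain ⟨b, hb⟩ := Orthonormal.exists_orthonormalBasis_extension_of_card_eq (𝕜 := ℝ)
    (E := EuclideanSpace ℝ (Fin (d + 1))) (ι := Fin (d + 1)) (by simp)
    (v := fun _ => y) (s := {0}) (by
      rw [orthonormal_subsingleton_iff]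
      simpa using hy)
  have hb0 : b 0 = y := hb 0 rfl
  have hmp := (volume_preserving_piFinSuccAbove (fun _ : Fin (d + 1) => ℝ) 0).comp
    ((PiLp.volume_preserving_ofLp (Fin (d + 1))).comp b.measurePreserving_repr)
  have hS : MeasurableSet {p : ℝ × (Fin d → ℝ) | c / s * √(∑ i, p.2 i ^ 2) ≤ |p.1|} :=
    measurableSet_le (by fun_prop) (by fun_prop)
  refine le_trans ?_ (lintegral_prod_tail_le (d := d) hc hs hcs)
  rw [← hmp.lintegral_comp (Measurable.indicator (by fun_prop) hS),
    ← lintegral_indicator (measurableSet_le (by fun_prop) (by fun_prop))]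
  refine lintegral_mono fun x => ?_
  rw [Set.indicator_apply]
  split_ifs with hx
  swap
  · exact zero_le
  set t : ℝ := b.repr x 0 with ht
  set q : ℝ := ∑ i : Fin d, b.repr x i.succ ^ 2 with hqdef
  have hq : 0 ≤ q := Finset.sum_nonneg fun i _ => sq_nonneg _
  have hnorm : ‖x‖ ^ 2 = t ^ 2 + q := by
    rw [← b.repr.norm_map, EuclideanSpace.real_norm_sq_eq, Fin.sum_univ_succ]
  have hxt : c * ‖x‖ ≤ |t| := by
    have : ⟪y, x⟫_ℝ = t := by rw [ht, b.repr_apply_apply, hb0]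
    rw [← this]
    exact hx
  have hle : c / s * √q ≤ |t| := by
    refine abs_le_of_sq_le_sq' ?_ (abs_nonneg t) |>.2
    have h := pow_le_pow_left₀ (by positivity) hxt 2
    rw [mul_pow, hnorm, sq_abs] at h
    rw [mul_pow, Real.sq_sqrt hq, div_pow, sq_abs, div_mul_eq_mul_div, div_le_iff₀ (by positivity)]
    linear_combination h - t ^ 2 * hcs
  rw [Function.comp_apply, Set.indicator_of_mem (by exact hle)]
  change _ ≤ ENNReal.ofReal (|t| * rexp (-t ^ 2)) * ENNReal.ofReal (rexp (-q) / c)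
  rw [← ENNReal.ofReal_mul (by positivity)]
  refine ENNReal.ofReal_le_ofReal ?_
  rw [hnorm, neg_add, Real.exp_add, mul_div_assoc', le_div_iff₀ hc]
  calc _ = c * ‖x‖ * (rexp (-t ^ 2) * rexp (-q)) := by ring
    _ ≤ |t| * (rexp (-t ^ 2) * rexp (-q)) := by gcongr
    _ = _ := by ring

lemma Gamma_sq_mul_lt {x : ℝ} (hx : 1 / 2 ≤ x) :
    Gamma x ^ 2 * (x - 1 / 2) < Gamma (x + 1 / 2) ^ 2 := by
  have hx0 : 0 < x := by linarith
  have h := Real.Gamma_mul_add_mul_le_rpow_Gamma_mul_rpow_Gamma (s := x + 1 / 2)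
    (t := x + 1 / 2 + 1) (a := 1 / 2) (b := 1 / 2) (by linarith) (by linarith)
    (by norm_num) (by norm_num) (by norm_num)
  have hG := Real.Gamma_pos_of_pos hx0
  have hG' := Real.Gamma_pos_of_pos (show 0 < x + 1 / 2 by linarith)
  rw [Real.Gamma_add_one (s := x + 1 / 2) (by linarith),
    show 1 / 2 * (x + 1 / 2) + 1 / 2 * (x + 1 / 2 + 1) = x + 1 by ring,
    Real.Gamma_add_one hx0.ne', ← Real.mul_rpow hG'.le (by positivity), ← Real.sqrt_eq_rpow] at h
  have h2 := (Real.le_sqrt' (by positivity)).1 h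
  refine lt_of_mul_lt_mul_right ?_ (show 0 ≤ x + 1 / 2 by linarith)
  nlinarith [pow_pos hG 2]

lemma integral_norm_mul_exp_neg_norm_sq (d : ℕ) :
    ∫ x : EuclideanSpace ℝ (Fin (d + 1)), ‖x‖ * rexp (-‖x‖ ^ 2) =
      √π ^ (d + 1) * Gamma (((d : ℝ) + 1) / 2 + 1 / 2) / Gamma (((d : ℝ) + 1) / 2) := by
  have h1 : ∫ r in Set.Ioi (0 : ℝ), r ^ d * (r * rexp (-r ^ 2)) =
      1 / 2 * Gamma (((d : ℝ) + 1) / 2 + 1 / 2) := by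
    have h := integral_rpow_mul_exp_neg_rpow (p := 2) (q := (d : ℝ) + 1) (by norm_num)
      (by have : (0 : ℝ) ≤ d := Nat.cast_nonneg d
          linarith)
    rw [add_div (d + 1 : ℝ) 1 2] at h
    rw [← h]
    refine setIntegral_congr_fun measurableSet_Ioi fun r _ => ?_
    rw [show ((d : ℝ) + 1) = ((d + 1 : ℕ) : ℝ) by push_cast; ring, Real.rpow_natCast,
      Real.rpow_two, pow_succ r d, mul_assoc]
  have hpos : 0 < Gamma (((d : ℝ) + 1) / 2) := Real.Gamma_pos_of_pos (by positivity)
  rw [integral_fun_norm_addHaar volume (fun r => r * rexp (-r ^ 2)), Measure.real,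
    EuclideanSpace.volume_ball]
  simp only [finrank_euclideanSpace, Fintype.card_fin, add_tsub_cancel_right, smul_eq_mul,
    ENNReal.ofReal_one, one_pow, one_mul, nsmul_eq_mul]
  rw [h1, ENNReal.toReal_ofReal (by positivity)]
  push_cast
  rw [Real.Gamma_add_one (by positivity)]
  field_simp

lemma lt_lintegral_norm_mul_exp_neg_norm_sq (d : ℕ) :
    ENNReal.ofReal (√π ^ d * √(π * d / 2)) <
      ∫⁻ x : EuclideanSpace ℝ (Fin (d + 1)), ENNReal.ofReal (‖x‖ * rexp (-‖x‖ ^ 2)) := by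
  have hpos : 0 < Gamma (((d : ℝ) + 1) / 2) := Real.Gamma_pos_of_pos (by positivity)
  have hpos' : 0 < Gamma (((d : ℝ) + 1) / 2 + 1 / 2) := Real.Gamma_pos_of_pos (by positivity)
  have hval := integral_norm_mul_exp_neg_norm_sq d
  have hvalpos : 0 < √π ^ (d + 1) * Gamma (((d : ℝ) + 1) / 2 + 1 / 2) /
      Gamma (((d : ℝ) + 1) / 2) := by positivity
  have hint : Integrable fun x : EuclideanSpace ℝ (Fin (d + 1)) => ‖x‖ * rexp (-‖x‖ ^ 2) :=
    not_imp_comm.1 integral_undef (hval ▸ hvalpos.ne')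
  rw [← ofReal_integral_eq_lintegral_ofReal hint
    (Eventually.of_forall fun x => by positivity), hval]
  refine (ENNReal.ofReal_lt_ofReal_iff hvalpos).2 ?_
  rw [mul_div_assoc (π : ℝ), Real.sqrt_mul Real.pi_pos.le, pow_succ, mul_div_assoc, mul_assoc]
  gcongr
  rw [lt_div_iff₀ hpos]
  refine lt_of_pow_lt_pow_left₀ 2 hpos'.le ?_
  rw [mul_pow, Real.sq_sqrt (by positivity)]
  have h := Gamma_sq_mul_lt (x := ((d : ℝ) + 1) / 2)
    (by have : (0 : ℝ) ≤ d := Nat.cast_nonneg d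
        linarith)
  linarith

/-- If packings have bounded size, one of maximal size exists, and its double cones cover. -/
lemma exists_packing_cover {n : ℕ} [NeZero n] {c : ℝ} (N : ℕ)
    (hN : ∀ A : Finset (EuclideanSpace ℝ (Fin n)), (∀ x ∈ A, ‖x‖ = 1) →
      (∀ x ∈ A, ∀ y ∈ A, x ≠ y → |⟪x, y⟫_ℝ| < c) → A.card ≤ N) (hc : c ≤ 1) :
    ∃ A : Finset (EuclideanSpace ℝ (Fin n)), (∀ x ∈ A, ‖x‖ = 1) ∧
      (∀ x ∈ A, ∀ y ∈ A, x ≠ y → |⟪x, y⟫_ℝ| < c) ∧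
      ∀ x, ∃ y ∈ A, c * ‖x‖ ≤ |⟪y, x⟫_ℝ| := by
  classical
  let P : ℕ → Prop := fun k => ∃ A : Finset (EuclideanSpace ℝ (Fin n)), (∀ x ∈ A, ‖x‖ = 1) ∧
    (∀ x ∈ A, ∀ y ∈ A, x ≠ y → |⟪x, y⟫_ℝ| < c) ∧ A.card = k
  obtain ⟨A, hA1, hA2, hcard⟩ : P (Nat.findGreatest P N) :=
    Nat.findGreatest_spec (P := P) (Nat.zero_le N) ⟨∅, by simp⟩
  have hunit : ∀ u : EuclideanSpace ℝ (Fin n), ‖u‖ = 1 → ∃ y ∈ A, c ≤ |⟪y, u⟫_ℝ| := by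
    intro u hu
    by_cases huA : u ∈ A
    · refine ⟨u, huA, ?_⟩
      rw [real_inner_self_eq_norm_sq, hu]
      simpa using hc
    by_contra! hcon
    have hB1 : ∀ x ∈ insert u A, ‖x‖ = 1 := by
      simpa [hu] using hA1
    have hB2 : ∀ x ∈ insert u A, ∀ y ∈ insert u A, x ≠ y → |⟪x, y⟫_ℝ| < c := by
      intro x hx y hy hxy
      rcases Finset.mem_insert.1 hx with hxu | hxA <;>
        rcases Finset.mem_insert.1 hy with hyu | hyA
      · exact absurd (hxu.trans hyu.symm) hxy
      · rw [hxu, real_inner_comm]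
        exact hcon y hyA
      · rw [hyu]
        exact hcon x hxA
      · exact hA2 x hxA y hyA hxy
    have h := Nat.le_findGreatest (P := P) (hN _ hB1 hB2) ⟨_, hB1, hB2, rfl⟩
    rw [Finset.card_insert_of_notMem huA] at h
    omega
  refine ⟨A, hA1, hA2, fun x => ?_⟩
  rcases eq_or_ne x 0 with rfl | hx
  · obtain ⟨y, hy, -⟩ := hunit (EuclideanSpace.single 0 1) (by simp)
    exact ⟨y, hy, by simp⟩
  · have hx' : 0 < ‖x‖ := norm_pos_iff.2 hx
    obtain ⟨y, hy, h⟩ := hunit (‖x‖⁻¹ • x) (by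
      rw [norm_smul, norm_inv, norm_norm, inv_mul_cancel₀ hx'.ne'])
    refine ⟨y, hy, ?_⟩
    rw [inner_smul_right, abs_mul, abs_of_pos (inv_pos.2 hx'), inv_mul_eq_div,
      le_div_iff₀ hx'] at h
    exact h

/-- For any `n ≥ 2` and `α ∈ (0, π/2)`, there exist more than
`m_α(n) = (π(n-1)/2)^{1/2} · cos α · (sin α)^{-(n-1)}` lines through the origin of `ℝⁿ`
such that any two of them determine an angle greater than `α`: there is a finite set `A`
of unit vectors with `|⟨x,y⟩| < cos α` for all distinct `x, y ∈ A` and `|A| > m_α(n)`. -/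
theorem stmt4 (n : ℕ) (hn : 2 ≤ n) (α : ℝ) (hα : α ∈ Set.Ioo 0 (π / 2)) :
    ∃ A : Finset (EuclideanSpace ℝ (Fin n)),
      (∀ x ∈ A, ‖x‖ = 1) ∧
      (∀ x ∈ A, ∀ y ∈ A, x ≠ y → |⟪x, y⟫_ℝ| < Real.cos α) ∧
      (A.card : ℝ) > Real.sqrt (π * ((n : ℝ) - 1) / 2) * Real.cos α / Real.sin α ^ (n - 1) := by
  obtain ⟨d, rfl⟩ : ∃ d, n = d + 1 := ⟨n - 1, by omega⟩
  have hs : 0 < Real.sin α := Real.sin_pos_of_pos_of_lt_pi hα.1 (by linarith [hα.2, Real.pi_pos])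
  have hc : 0 < Real.cos α := Real.cos_pos_of_mem_Ioo ⟨by linarith [hα.1, Real.pi_pos], hα.2⟩
  by_contra! hcon
  obtain ⟨A, hA1, hA2, hcover⟩ := exists_packing_cover _
    (fun A h1 h2 => Nat.le_floor (hcon A h1 h2)) (Real.cos_le_one α)
  have hcard := hcon A hA1 hA2
  let μ : Measure (EuclideanSpace ℝ (Fin (d + 1))) :=
    volume.withDensity fun x => ENNReal.ofReal (‖x‖ * rexp (-‖x‖ ^ 2))
  let C : EuclideanSpace ℝ (Fin (d + 1)) → Set (EuclideanSpace ℝ (Fin (d + 1))) :=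
    fun y => {x | Real.cos α * ‖x‖ ≤ |⟪y, x⟫_ℝ|}
  have hcone : ∀ y ∈ A, μ (C y) ≤ ENNReal.ofReal (√π ^ d * Real.sin α ^ d / Real.cos α) := by
    intro y hy
    rw [withDensity_apply _ (measurableSet_le (by fun_prop) (by fun_prop))]
    exact lintegral_cone_le hc hs (Real.sin_sq_add_cos_sq α) (hA1 y hy)
  have hlt : ENNReal.ofReal (√π ^ d * √(π * d / 2)) <
      ENNReal.ofReal (A.card * (√π ^ d * Real.sin α ^ d / Real.cos α)) := by
    calc _ < μ Set.univ := by
          rw [withDensity_apply _ MeasurableSet.univ, setLIntegral_univ]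
          exact lt_lintegral_norm_mul_exp_neg_norm_sq d
      _ ≤ μ (⋃ y ∈ A, C y) := measure_mono fun x _ => by
          obtain ⟨y, hy, h⟩ := hcover x
          exact Set.mem_biUnion hy h
      _ ≤ ∑ y ∈ A, μ (C y) := measure_biUnion_finset_le _ _
      _ ≤ ∑ _y ∈ A, ENNReal.ofReal (√π ^ d * Real.sin α ^ d / Real.cos α) :=
          Finset.sum_le_sum hcone
      _ = _ := by
          rw [Finset.sum_const, nsmul_eq_mul, ENNReal.ofReal_mul (by positivity),
            ENNReal.ofReal_natCast]
  refine absurd (ENNReal.ofReal_lt_ofReal_iff_of_nonneg (by positivity) |>.1 hlt) (not_lt.2 ?_)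
  rw [add_tsub_cancel_right, Nat.cast_add_one, add_sub_cancel_right] at hcard
  calc _ ≤ √(π * d / 2) * Real.cos α / Real.sin α ^ d *
        (√π ^ d * Real.sin α ^ d / Real.cos α) := by gcongr
    _ = _ := by field_simp
end

section
/- Let n ≥ 1 be an integer, let y be a unit vector in ℝⁿ, and let ε ∈ (0, 1]. Then the uniform probability measure σ_{n−1} of the spherical cap C(y, ε) := { x ∈ S^{n−1} : ⟨x, y⟩ ≥ ε } satisfies σ_{n−1}(C(y, ε)) ≤ exp(−n ε² / 2). -/
open MeasureTheory Real
open scoped InnerProductSpace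

/-- `σ` is the uniform probability measure on the unit sphere `S^{n-1} ⊂ ℝⁿ`:
the unique rotation-invariant Borel probability measure concentrated on the sphere. -/
def IsUniformOnSphere {n : ℕ} (σm : Measure (EuclideanSpace ℝ (Fin n))) : Prop :=
  IsProbabilityMeasure σm ∧ σm {x | ‖x‖ = 1}ᶜ = 0 ∧
    ∀ O : EuclideanSpace ℝ (Fin n) ≃ₗᵢ[ℝ] EuclideanSpace ℝ (Fin n), σm.map O = σm

/-- The Laplace transform of a rotation-invariant measure depends only on the
norm of its argument. -/
theorem lintegral_exp_inner_eq_of_norm_eq {E : Type*} [NormedAddCommGroup E]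
    [InnerProductSpace ℝ E] [CompleteSpace E] [MeasurableSpace E] [BorelSpace E] {μ : Measure E}
    (hμ : ∀ O : E ≃ₗᵢ[ℝ] E, μ.map O = μ) {y z : E} (h : ‖y‖ = ‖z‖) (t : ℝ) :
    ∫⁻ x, ENNReal.ofReal (exp (t * ⟪x, y⟫_ℝ)) ∂μ =
      ∫⁻ x, ENNReal.ofReal (exp (t * ⟪x, z⟫_ℝ)) ∂μ := by
  let O : E ≃ₗᵢ[ℝ] E := (ℝ ∙ (y - z))ᗮ.reflection
  have hO : O y = z := Submodule.reflection_sub h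
  have hm : Measurable fun x : E => ENNReal.ofReal (exp (t * ⟪x, z⟫_ℝ)) :=
    (by fun_prop : Continuous fun x : E => exp (t * ⟪x, z⟫_ℝ)).measurable.ennreal_ofReal
  conv_rhs => rw [← hμ O, lintegral_map hm O.continuous.measurable]
  simp only [← hO, LinearIsometryEquiv.inner_map_map]

/-- The sum over all sign vectors of the exponentials of the signed sums of `a` is at most
`2 ^ n` times a Gaussian in `a`. -/
theorem sum_exp_sum_sign_le {n : ℕ} (a : Fin n → ℝ) :
    ∑ g : Fin n → Bool, exp (∑ i, (if g i then 1 else -1) * a i) ≤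
      2 ^ n * exp ((∑ i, a i ^ 2) / 2) := by
  have h : ∑ g : Fin n → Bool, exp (∑ i, (if g i then 1 else -1) * a i) =
      ∏ i, (2 * cosh (a i)) := by
    have key := Finset.prod_univ_sum (fun _ : Fin n => (Finset.univ : Finset Bool))
      (fun i b => exp ((if b then 1 else -1) * a i))
    rw [Fintype.piFinset_univ] at key
    simp only [exp_sum]
    rw [← key]
    refine Finset.prod_congr rfl fun i _ => ?_
    simp [Real.cosh_eq]
    ring
  rw [h, Finset.prod_mul_distrib, Finset.sum_div, exp_sum]
  simp only [Finset.prod_const, Finset.card_univ, Fintype.card_fin]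
  gcongr with i
  exact cosh_le_exp_half_sq _

/-- The uniform measure on `S^{n-1}` is sub-Gaussian with variance proxy `1 / n`. -/
theorem IsUniformOnSphere.lintegral_exp_inner_le {n : ℕ} (hn : 1 ≤ n)
    {μ : Measure (EuclideanSpace ℝ (Fin n))} (hμ : IsUniformOnSphere μ)
    {y : EuclideanSpace ℝ (Fin n)} (hy : ‖y‖ = 1) (t : ℝ) :
    ∫⁻ x, ENNReal.ofReal (exp (t * ⟪x, y⟫_ℝ)) ∂μ ≤ ENNReal.ofReal (exp (t ^ 2 / (2 * n))) := by
  obtain ⟨hprob, hsupp, hrot⟩ := hμ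
  have hn0 : (0 : ℝ) < n := by exact_mod_cast hn
  let z : (Fin n → Bool) → EuclideanSpace ℝ (Fin n) :=
    fun g => WithLp.toLp 2 fun i => (if g i then 1 else -1) * (√n)⁻¹
  have hz (g) : ‖y‖ = ‖z g‖ := by
    rw [hy, eq_comm, EuclideanSpace.norm_eq, sqrt_eq_one]
    have (i : Fin n) : ‖z g i‖ ^ 2 = (n : ℝ)⁻¹ := by
      rw [Real.norm_eq_abs, sq_abs]
      by_cases hi : g i <;> simp [z, hi, sq_sqrt hn0.le]
    simp_rw [this]
    simp [hn0.ne']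
  have hinner (g) (x : EuclideanSpace ℝ (Fin n)) :
      t * ⟪x, z g⟫_ℝ = ∑ i, (if g i then 1 else -1) * (t * (√n)⁻¹ * x i) := by
    simp only [PiLp.inner_apply, RCLike.inner_apply, conj_trivial, Finset.mul_sum, z]
    exact Finset.sum_congr rfl fun i _ => by ring
  have hae : ∀ᵐ x ∂μ, ∑ g, ENNReal.ofReal (exp (t * ⟪x, z g⟫_ℝ)) ≤
      2 ^ n * ENNReal.ofReal (exp (t ^ 2 / (2 * n))) := by
    have hnorm : ∀ᵐ x ∂μ, ‖x‖ = 1 := hsupp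
    filter_upwards [hnorm] with x hx
    rw [← ENNReal.ofReal_sum_of_nonneg fun _ _ => (exp_pos _).le]
    simp only [hinner]
    have hs : ∑ i, (t * (√n)⁻¹ * x i) ^ 2 = t ^ 2 / n := by
      have h1 : ∑ i, x i ^ 2 = 1 := by
        rw [← EuclideanSpace.real_norm_sq_eq, hx, one_pow]
      simp only [mul_pow, ← Finset.mul_sum, h1, inv_pow, sq_sqrt hn0.le]
      ring
    refine (ENNReal.ofReal_le_ofReal (sum_exp_sum_sign_le _)).trans_eq ?_
    rw [hs, ENNReal.ofReal_mul (by positivity), ENNReal.ofReal_pow (by norm_num),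
      ENNReal.ofReal_ofNat, div_div, mul_comm (n : ℝ) 2]
  have hsum : 2 ^ n * ∫⁻ x, ENNReal.ofReal (exp (t * ⟪x, y⟫_ℝ)) ∂μ ≤
      2 ^ n * ENNReal.ofReal (exp (t ^ 2 / (2 * n))) :=
    calc
      _ = ∑ g, ∫⁻ x, ENNReal.ofReal (exp (t * ⟪x, z g⟫_ℝ)) ∂μ := by
        simp [← fun g => lintegral_exp_inner_eq_of_norm_eq hrot (hz g) t]
      _ = ∫⁻ x, ∑ g, ENNReal.ofReal (exp (t * ⟪x, z g⟫_ℝ)) ∂μ :=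
        (lintegral_finsetSum _ fun g _ => (by fun_prop :
          Continuous fun x => exp (t * ⟪x, z g⟫_ℝ)).measurable.ennreal_ofReal).symm
      _ ≤ ∫⁻ _, 2 ^ n * ENNReal.ofReal (exp (t ^ 2 / (2 * n))) ∂μ := lintegral_mono_ae hae
      _ = _ := by simp
  exact (ENNReal.mul_le_mul_iff_right (by simp) (by simp)).1 hsum

/-- For `n ≥ 1`, a unit vector `y ∈ ℝⁿ`, and `ε ∈ (0,1]`, the uniform measure of the
spherical cap `C(y,ε) = {x ∈ S^{n-1} : ⟨x,y⟩ ≥ ε}` is at most `exp(-n ε²/2)`. -/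
theorem stmt6 (n : ℕ) (hn : 1 ≤ n)
    (σm : Measure (EuclideanSpace ℝ (Fin n))) (hσ : IsUniformOnSphere σm)
    (y : EuclideanSpace ℝ (Fin n)) (hy : ‖y‖ = 1)
    (ε : ℝ) (hε : ε ∈ Set.Ioc (0 : ℝ) 1) :
    σm {x | ε ≤ ⟪x, y⟫_ℝ} ≤ ENNReal.ofReal (Real.exp (-(n : ℝ) * ε ^ 2 / 2)) := by
  have hn0 : (n : ℝ) ≠ 0 := by exact_mod_cast (by lia : n ≠ 0)
  calc
    σm {x | ε ≤ ⟪x, y⟫_ℝ} = ∫⁻ _ in {x | ε ≤ ⟪x, y⟫_ℝ}, 1 ∂σm := by simp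
    _ ≤ ∫⁻ x in {x | ε ≤ ⟪x, y⟫_ℝ},
        ENNReal.ofReal (exp (-(n * ε ^ 2))) * ENNReal.ofReal (exp (n * ε * ⟪x, y⟫_ℝ)) ∂σm := by
      refine setLIntegral_mono' (measurableSet_le measurable_const
        (by fun_prop : Continuous fun x => ⟪x, y⟫_ℝ).measurable) fun x hx => ?_
      rw [← ENNReal.ofReal_mul (exp_pos _).le, ← exp_add, ← ENNReal.ofReal_one]
      refine ENNReal.ofReal_le_ofReal (one_le_exp ?_)
      have := mul_le_mul_of_nonneg_left (show ε ≤ ⟪x, y⟫_ℝ from hx)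
        (mul_nonneg n.cast_nonneg hε.1.le : (0 : ℝ) ≤ n * ε)
      linarith
    _ ≤ ∫⁻ x,
        ENNReal.ofReal (exp (-(n * ε ^ 2))) * ENNReal.ofReal (exp (n * ε * ⟪x, y⟫_ℝ)) ∂σm :=
      setLIntegral_le_lintegral _ _
    _ = ENNReal.ofReal (exp (-(n * ε ^ 2))) *
        ∫⁻ x, ENNReal.ofReal (exp (n * ε * ⟪x, y⟫_ℝ)) ∂σm :=
      lintegral_const_mul' _ _ ENNReal.ofReal_ne_top
    _ ≤ ENNReal.ofReal (exp (-(n * ε ^ 2))) *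
        ENNReal.ofReal (exp ((n * ε) ^ 2 / (2 * n))) := by
      gcongr
      exact hσ.lintegral_exp_inner_le hn hy _
    _ = ENNReal.ofReal (exp (-(n : ℝ) * ε ^ 2 / 2)) := by
      rw [← ENNReal.ofReal_mul (exp_pos _).le, ← exp_add]
      congr 2
      field_simp
      ring
end

section
/- Let a, b, c be real numbers with c > a > 0 and b > 0, and let z ∈ (−1, 1). Then the Gauss hypergeometric series admits the Euler integral representation ₂F₁(a, b; c; z) = Σ_{k=0}^{∞} ((a)_k (b)_k / (c)_k) · z^k / k! = (Γ(c) / (Γ(a) Γ(c−a))) · ∫₀¹ t^{a−1} (1−t)^{c−a−1} (1 − z t)^{−b} dt, where the integral on the right converges absolutely. -/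
open MeasureTheory Real

/-- The binomial series of `(1 - x) ^ (-b)`, written with rising factorials. -/
theorem hasSum_ascPochhammer_mul_pow_div_factorial (b : ℝ) {x : ℝ} (hx : |x| < 1) :
    HasSum (fun k : ℕ => (ascPochhammer ℝ k).eval b * x ^ k / (k.factorial : ℝ))
      ((1 - x) ^ (-b)) := by
  have h := (Real.one_div_one_sub_rpow_hasFPowerSeriesOnBall_zero b).hasSum
    (y := x) (by simpa [enorm_eq_nnnorm, ← NNReal.coe_lt_coe] using hx)
  have h1 : 0 < 1 - x := by linarith [(abs_lt.mp hx).2]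
  rw [Real.rpow_neg h1.le, ← one_div]
  rw [zero_add] at h
  refine h.congr_fun fun k => ?_
  have hk := Ring.factorial_nsmul_multichoose_eq_ascPochhammer b k
  rw [Polynomial.ascPochhammer_smeval_cast, Polynomial.ascPochhammer_smeval_eq_eval,
    nsmul_eq_mul] at hk
  have hc : Ring.choose (b + k - 1) k = Ring.multichoose b k := by
    rw [Ring.choose]
    congr 1
    ring
  have hf : (k.factorial : ℝ) ≠ 0 := by positivity
  rw [FormalMultilinearSeries.ofScalars_apply_eq, hc, ← hk, smul_eq_mul]
  field_simp

theorem Gamma_add_natCast_eq_ascPochhammer_mul {a : ℝ} (ha : 0 < a) (n : ℕ) :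
    Real.Gamma (a + n) = (ascPochhammer ℝ n).eval a * Real.Gamma a := by
  induction n with
  | zero => simp
  | succ n ih =>
    have h : a + n ≠ 0 := by positivity
    rw [Nat.cast_succ, ← add_assoc, Real.Gamma_add_one h, ih, ascPochhammer_succ_eval]
    ring

theorem integrableOn_rpow_mul_one_sub_rpow {u v : ℝ} (hu : 0 < u) (hv : 0 < v) :
    IntegrableOn (fun t : ℝ => t ^ (u - 1) * (1 - t) ^ (v - 1)) (Set.Ioo 0 1) := by
  have h := Complex.betaIntegral_convergent (u := u) (v := v) (by simpa) (by simpa)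
  rw [intervalIntegrable_iff_integrableOn_Ioo_of_le zero_le_one] at h
  refine IntegrableOn.congr_fun (f := fun t : ℝ => RCLike.re
    ((t : ℂ) ^ ((u : ℂ) - 1) * (1 - (t : ℂ)) ^ ((v : ℂ) - 1))) h.re (fun t ht => ?_)
    measurableSet_Ioo
  have h1 : (0 : ℝ) ≤ 1 - t := by linarith [ht.2]
  have e : (t : ℂ) ^ ((u : ℂ) - 1) * (1 - (t : ℂ)) ^ ((v : ℂ) - 1)
      = ((t ^ (u - 1) * (1 - t) ^ (v - 1) : ℝ) : ℂ) := by
    push_cast [Complex.ofReal_cpow ht.1.le, Complex.ofReal_cpow h1]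
    rfl
  simp only [e]
  exact Complex.ofReal_re _

/-- The Beta integral over the reals. -/
theorem integral_rpow_mul_one_sub_rpow {u v : ℝ} (hu : 0 < u) (hv : 0 < v) :
    ∫ t in Set.Ioo (0 : ℝ) 1, t ^ (u - 1) * (1 - t) ^ (v - 1)
      = Real.Gamma u * Real.Gamma v / Real.Gamma (u + v) := by
  have h := Complex.betaIntegral_eq_Gamma_mul_div u v (by simpa) (by simpa)
  rw [Complex.betaIntegral, intervalIntegral.integral_of_le zero_le_one,
    integral_Ioc_eq_integral_Ioo,
    setIntegral_congr_fun (g := fun t : ℝ => ((t ^ (u - 1) * (1 - t) ^ (v - 1) : ℝ) : ℂ))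
      measurableSet_Ioo, integral_complex_ofReal, ← Complex.ofReal_add] at h
  · simp only [Complex.Gamma_ofReal] at h
    exact_mod_cast h
  · intro t ht
    have h1 : (0 : ℝ) ≤ 1 - t := by linarith [ht.2]
    push_cast [Complex.ofReal_cpow ht.1.le, Complex.ofReal_cpow h1]
    rfl

/-- Euler integral representation of the Gauss hypergeometric function: for real
`c > a > 0`, `b > 0` and `z ∈ (-1,1)`, the integrand `t^{a-1}(1-t)^{c-a-1}(1-zt)^{-b}` is
(absolutely) integrable on `(0,1)` and
`₂F₁(a,b;c;z) = Σ_k ((a)_k (b)_k/(c)_k) z^k/k! = (Γ(c)/(Γ(a)Γ(c-a))) ∫₀¹ t^{a-1}(1-t)^{c-a-1}(1-zt)^{-b} dt`. -/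
theorem stmt12 (a b c : ℝ) (ha : 0 < a) (hac : a < c) (hb : 0 < b)
    (z : ℝ) (hz : z ∈ Set.Ioo (-1 : ℝ) 1) :
    IntegrableOn
      (fun t : ℝ => t ^ (a - 1) * (1 - t) ^ (c - a - 1) * (1 - z * t) ^ (-b))
      (Set.Ioo (0 : ℝ) 1) volume ∧
    (∑' k : ℕ, ((ascPochhammer ℝ k).eval a * (ascPochhammer ℝ k).eval b /
        (ascPochhammer ℝ k).eval c) * z ^ k / (k.factorial : ℝ))
      = (Real.Gamma c / (Real.Gamma a * Real.Gamma (c - a))) *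
        ∫ t in Set.Ioo (0 : ℝ) 1,
          t ^ (a - 1) * (1 - t) ^ (c - a - 1) * (1 - z * t) ^ (-b) := by
  have hca : 0 < c - a := sub_pos.mpr hac
  have hc : 0 < c := ha.trans hac
  have hz1 : |z| < 1 := abs_lt.mpr hz
  have hzt : ∀ t ∈ Set.Ioo (0 : ℝ) 1, |z * t| ≤ |z| := fun t ht => by
    rw [abs_mul, abs_of_pos ht.1]
    exact mul_le_of_le_one_right (abs_nonneg z) ht.2.le
  have hw := integrableOn_rpow_mul_one_sub_rpow ha hca
  have hw0 : ∀ t ∈ Set.Ioo (0 : ℝ) 1, 0 ≤ t ^ (a - 1) * (1 - t) ^ (c - a - 1) := fun t ht =>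
    mul_nonneg (Real.rpow_nonneg ht.1.le _) (Real.rpow_nonneg (by linarith [ht.2]) _)
  have hpoch : ∀ k : ℕ, 0 < (ascPochhammer ℝ k).eval b := fun k => ascPochhammer_pos k b hb
  constructor
  · refine Integrable.mono' (hw.mul_const ((1 - |z|) ^ (-b)))
      (Measurable.aestronglyMeasurable (by fun_prop))
      (ae_restrict_of_forall_mem measurableSet_Ioo fun t ht => ?_)
    have h1 : 1 - |z| ≤ 1 - z * t := by linarith [(le_abs_self (z * t)).trans (hzt t ht)]
    have h0 : 0 < 1 - |z| := by linarith
    rw [Real.norm_of_nonneg (mul_nonneg (hw0 t ht) (Real.rpow_nonneg (h0.le.trans h1) _))]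
    exact mul_le_mul_of_nonneg_left
      (Real.rpow_le_rpow_of_nonpos h0 h1 (neg_nonpos.mpr hb.le)) (hw0 t ht)
  · have hbound : ∀ t : ℝ, HasSum (fun k : ℕ => t ^ (a - 1) * (1 - t) ^ (c - a - 1) *
        ((ascPochhammer ℝ k).eval b * |z| ^ k / (k.factorial : ℝ)))
        (t ^ (a - 1) * (1 - t) ^ (c - a - 1) * (1 - |z|) ^ (-b)) := fun t =>
      (hasSum_ascPochhammer_mul_pow_div_factorial b (by rwa [abs_abs])).mul_left _
    have hsum := hasSum_integral_of_dominated_convergence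
      (μ := volume.restrict (Set.Ioo (0 : ℝ) 1))
      (F := fun (k : ℕ) (t : ℝ) => t ^ (a - 1) * (1 - t) ^ (c - a - 1) *
        ((ascPochhammer ℝ k).eval b * (z * t) ^ k / (k.factorial : ℝ)))
      (f := fun t : ℝ => t ^ (a - 1) * (1 - t) ^ (c - a - 1) * (1 - z * t) ^ (-b))
      (fun k t => t ^ (a - 1) * (1 - t) ^ (c - a - 1) *
        ((ascPochhammer ℝ k).eval b * |z| ^ k / (k.factorial : ℝ)))
      (fun k => Measurable.aestronglyMeasurable (by fun_prop))
      (fun k => ae_restrict_of_forall_mem measurableSet_Ioo fun t ht => by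
        have h1 := hpoch k
        rw [norm_mul, Real.norm_of_nonneg (hw0 t ht), norm_div, norm_mul, norm_pow,
          Real.norm_of_nonneg h1.le, Real.norm_eq_abs (z * t), Real.norm_natCast]
        have h2 := hw0 t ht
        have h3 := hzt t ht
        gcongr)
      (Filter.Eventually.of_forall fun t => (hbound t).summable)
      (by
        simp only [fun t => (hbound t).tsum_eq]
        exact hw.mul_const _)
      (ae_restrict_of_forall_mem measurableSet_Ioo fun t ht =>
        (hasSum_ascPochhammer_mul_pow_div_factorial b ((hzt t ht).trans_lt hz1)).mul_left _)
    rw [← (hsum.mul_left (Real.Gamma c / (Real.Gamma a * Real.Gamma (c - a)))).tsum_eq]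
    refine tsum_congr fun k => ?_
    have hterm : ∫ t in Set.Ioo (0 : ℝ) 1, t ^ (a - 1) * (1 - t) ^ (c - a - 1) *
          ((ascPochhammer ℝ k).eval b * (z * t) ^ k / (k.factorial : ℝ))
        = (ascPochhammer ℝ k).eval b * z ^ k / (k.factorial : ℝ) *
          (Real.Gamma (a + k) * Real.Gamma (c - a) / Real.Gamma (c + k)) := by
      have hak : 0 < a + k := by positivity
      rw [show c + k = a + k + (c - a) by ring, ← integral_rpow_mul_one_sub_rpow hak hca,
        ← integral_const_mul]
      refine setIntegral_congr_fun measurableSet_Ioo fun t ht => ?_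
      simp only [show a + k - 1 = a - 1 + (k : ℝ) by ring, Real.rpow_add_natCast ht.1.ne', mul_pow]
      ring
    rw [hterm, Gamma_add_natCast_eq_ascPochhammer_mul ha, Gamma_add_natCast_eq_ascPochhammer_mul hc]
    have h1 := (Real.Gamma_pos_of_pos ha).ne'
    have h2 := (Real.Gamma_pos_of_pos hc).ne'
    have h3 := (Real.Gamma_pos_of_pos hca).ne'
    have h4 := (ascPochhammer_pos k c hc).ne'
    field_simp
end
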